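/- arXiv:2507.10390 — 2 statements merged into one kernel-verified Lean document; each statement's English description precedes it below -/
import Mathlib

section
/- Let N>0, fix integers m>0, n>0, set k:=(m,n)∈ℝ² and k^⊥:=(n,−m). For μ=(μ₁,μ₂)∈ℝ² with μ≠0, k+μ≠0, μ₁≠0, m+μ₁≠0 and ‖μ‖≠‖k‖, define Ω(v):=N·v₁/‖v‖, 𝚎(μ) := (k^⊥·μ)²·(‖k+μ‖−‖k‖)·(‖k‖+‖μ‖)·(‖k+μ‖+‖k‖−‖μ‖)² / (16·N²·‖μ‖²·‖k+μ‖²·‖k‖²), I₊(μ) := (k^⊥·μ)·[Ω(k+μ)·(‖k‖²−‖μ‖²) + (m+μ₁)·N·(‖k‖−‖μ‖)] / (2·Ω(k+μ)·‖k+μ‖²), and I₋(μ) := −(k^⊥·μ)·[Ω(μ)·(‖k‖²−‖k+μ‖²) + μ₁·N·(‖k‖−‖k+μ‖)] / (2·Ω(μ)·‖μ‖²). Then 𝚎(μ) = (I₊(μ)·I₋(μ)/(4·N²·‖k‖²)) · ((‖k+μ‖+‖k‖−‖μ‖)/(‖k+μ‖+‖k‖+‖μ‖))² · (‖k‖+‖μ‖)/(‖k‖−‖μ‖).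 -/
/-- Dispersion relation `Ω(v) = N v₁ / ‖v‖` (for `v ≠ 0`). -/
noncomputable def Omg (N : ℝ) (v : ℝ × ℝ) : ℝ := N * v.1 / Real.sqrt (v.1 ^ 2 + v.2 ^ 2)

/-- The instability coefficient `𝚎(μ)` of Theorem 2.7, with `k = (m,n)`, `k^⊥ = (n,−m)`. -/
noncomputable def efun (N : ℝ) (m n : ℤ) (μ : ℝ × ℝ) : ℝ :=
  let nk : ℝ := Real.sqrt ((m : ℝ) ^ 2 + (n : ℝ) ^ 2);
  let nμ : ℝ := Real.sqrt (μ.1 ^ 2 + μ.2 ^ 2);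
  let nkμ : ℝ := Real.sqrt (((m : ℝ) + μ.1) ^ 2 + ((n : ℝ) + μ.2) ^ 2);
  ((n : ℝ) * μ.1 - (m : ℝ) * μ.2) ^ 2 * (nkμ - nk) * (nk + nμ) * (nkμ + nk - nμ) ^ 2
    / (16 * N ^ 2 * nμ ^ 2 * nkμ ^ 2 * nk ^ 2)

/-- Growth-rate factor `I₊(μ)` from the physics literature, with `k = (m,n)`. -/
noncomputable def Iplus (N : ℝ) (m n : ℤ) (μ : ℝ × ℝ) : ℝ :=
  let k : ℝ × ℝ := ((m : ℝ), (n : ℝ));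
  let nk : ℝ := Real.sqrt ((m : ℝ) ^ 2 + (n : ℝ) ^ 2);
  let nμ : ℝ := Real.sqrt (μ.1 ^ 2 + μ.2 ^ 2);
  let nkμ : ℝ := Real.sqrt (((m : ℝ) + μ.1) ^ 2 + ((n : ℝ) + μ.2) ^ 2);
  ((n : ℝ) * μ.1 - (m : ℝ) * μ.2)
    * (Omg N (k + μ) * (nk ^ 2 - nμ ^ 2) + ((m : ℝ) + μ.1) * N * (nk - nμ))
    / (2 * Omg N (k + μ) * nkμ ^ 2)

/-- Growth-rate factor `I₋(μ)` from the physics literature, with `k = (m,n)`. -/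
noncomputable def Iminus (N : ℝ) (m n : ℤ) (μ : ℝ × ℝ) : ℝ :=
  let nk : ℝ := Real.sqrt ((m : ℝ) ^ 2 + (n : ℝ) ^ 2);
  let nμ : ℝ := Real.sqrt (μ.1 ^ 2 + μ.2 ^ 2);
  let nkμ : ℝ := Real.sqrt (((m : ℝ) + μ.1) ^ 2 + ((n : ℝ) + μ.2) ^ 2);
  -(((n : ℝ) * μ.1 - (m : ℝ) * μ.2)
      * (Omg N μ * (nk ^ 2 - nkμ ^ 2) + μ.1 * N * (nk - nkμ)))
    / (2 * Omg N μ * nμ ^ 2)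

/-- the identity relating the instability coefficient `𝚎(μ)` with the
growth-rate factors `I₊(μ)·I₋(μ)` of the physics literature (Section 6). -/
theorem e_eq_Iplus_Iminus (N : ℝ) (hN : 0 < N) (m n : ℤ) (hm : 0 < m) (hn : 0 < n)
    (μ : ℝ × ℝ) (hμ : μ ≠ 0) (hkμ : (((m : ℝ), (n : ℝ)) : ℝ × ℝ) + μ ≠ 0)
    (hμ1 : μ.1 ≠ 0) (hmμ1 : (m : ℝ) + μ.1 ≠ 0)
    (hnorm : Real.sqrt (μ.1 ^ 2 + μ.2 ^ 2) ≠ Real.sqrt ((m : ℝ) ^ 2 + (n : ℝ) ^ 2)) :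
    let nk : ℝ := Real.sqrt ((m : ℝ) ^ 2 + (n : ℝ) ^ 2)
    let nμ : ℝ := Real.sqrt (μ.1 ^ 2 + μ.2 ^ 2)
    let nkμ : ℝ := Real.sqrt (((m : ℝ) + μ.1) ^ 2 + ((n : ℝ) + μ.2) ^ 2)
    efun N m n μ
      = (Iplus N m n μ * Iminus N m n μ / (4 * N ^ 2 * nk ^ 2))
        * ((nkμ + nk - nμ) / (nkμ + nk + nμ)) ^ 2 * ((nk + nμ) / (nk - nμ)) := by
  intro nk nμ nkμ
  have hb : 0 < nμ := Real.sqrt_pos.mpr (by positivity)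
  have hc : 0 < nkμ := Real.sqrt_pos.mpr (by positivity)
  have hm' : (0 : ℝ) < m := by exact_mod_cast hm
  have ha : 0 < nk := Real.sqrt_pos.mpr (by positivity)
  have hab : nk - nμ ≠ 0 := sub_ne_zero.mpr (Ne.symm hnorm)
  have hN' : N ≠ 0 := hN.ne'
  have hS : nkμ + nk + nμ ≠ 0 := by positivity
  have hO1 : Omg N (((m : ℝ), (n : ℝ)) + μ) = N * ((m : ℝ) + μ.1) / nkμ := rfl
  have hO2 : Omg N μ = N * μ.1 / nμ := rfl
  have h1 : Iplus N m n μ = ((n : ℝ) * μ.1 - (m : ℝ) * μ.2) * (nk - nμ) * (nkμ + nk + nμ)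
      / (2 * nkμ ^ 2) := by
    change ((n : ℝ) * μ.1 - (m : ℝ) * μ.2)
      * (Omg N (((m : ℝ), (n : ℝ)) + μ) * (nk ^ 2 - nμ ^ 2) + ((m : ℝ) + μ.1) * N * (nk - nμ))
      / (2 * Omg N (((m : ℝ), (n : ℝ)) + μ) * nkμ ^ 2) = _
    rw [hO1]
    clear_value nk nμ nkμ
    field_simp
    ring
  have h2 : Iminus N m n μ = ((n : ℝ) * μ.1 - (m : ℝ) * μ.2) * (nkμ - nk) * (nkμ + nk + nμ)
      / (2 * nμ ^ 2) := by
    change -(((n : ℝ) * μ.1 - (m : ℝ) * μ.2)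
      * (Omg N μ * (nk ^ 2 - nkμ ^ 2) + μ.1 * N * (nk - nkμ)))
      / (2 * Omg N μ * nμ ^ 2) = _
    rw [hO2]
    clear_value nk nμ nkμ
    field_simp
    ring
  have h3 : efun N m n μ = ((n : ℝ) * μ.1 - (m : ℝ) * μ.2) ^ 2 * (nkμ - nk) * (nk + nμ)
      * (nkμ + nk - nμ) ^ 2 / (16 * N ^ 2 * nμ ^ 2 * nkμ ^ 2 * nk ^ 2) := rfl
  rw [h1, h2, h3]
  clear_value nk nμ nkμ
  field_simp
  ring
end

section
/- Let N>0, fix integers m>0, n>0, set k:=(m,n)∈ℝ², k^⊥:=(n,−m), and define F(x,y):=(m+x)/√((m+x)²+(n+y)²) + x/√(x²+y²) − m/√(m²+n²), 𝚎(μ) := (k^⊥·μ)²·(‖k+μ‖−‖k‖)·(‖k‖+‖μ‖)·(‖k+μ‖+‖k‖−‖μ‖)² / (16·N²·‖μ‖²·‖k+μ‖²·‖k‖²), Ω(v):=N·v₁/‖v‖, I₊(μ) := (k^⊥·μ)·[Ω(k+μ)·(‖k‖²−‖μ‖²) + (m+μ₁)·N·(‖k‖−‖μ‖)] / (2·Ω(k+μ)·‖k+μ‖²),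 and I₋(μ) := −(k^⊥·μ)·[Ω(μ)·(‖k‖²−‖k+μ‖²) + μ₁·N·(‖k‖−‖k+μ‖)] / (2·Ω(μ)·‖μ‖²). Let 0<δ<n and let φ₊:(0,δ)→ℝ and φ₋:(−δ,0)→ℝ satisfy F(φ₊(y),y)=0 for y∈(0,δ) and F(φ₋(y),y)=0 for y∈(−δ,0), and define μ(τ):=(φ₊(n·τ), n·τ) for 0<τ<δ/n and μ(τ):=(φ₋(n·τ), n·τ) for −δ/n<τ<0. Then lim_{τ→0, τ≠0} 𝚎(μ(τ)) / (I₊(μ(τ))·I₋(μ(τ))) = 1/(4·N²·(m²+n²)). -/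
/-- The function whose zero set characterizes the resonant set `R_k` away from `0` and `-k`. -/
noncomputable def Ffun (m n : ℤ) (x y : ℝ) : ℝ :=
  ((m : ℝ) + x) / Real.sqrt (((m : ℝ) + x) ^ 2 + ((n : ℝ) + y) ^ 2)
    + x / Real.sqrt (x ^ 2 + y ^ 2)
    - (m : ℝ) / Real.sqrt ((m : ℝ) ^ 2 + (n : ℝ) ^ 2)

open Filter Topology

lemma aux_bound (m n : ℝ) (hm : 0 < m) (hn : 0 < n) (x y : ℝ) (hy : y ≠ 0)
    (hF : (m + x) / Real.sqrt ((m + x) ^ 2 + (n + y) ^ 2) + x / Real.sqrt (x ^ 2 + y ^ 2)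
      - m / Real.sqrt (m ^ 2 + n ^ 2) = 0) :
    |x| * (1 - max (m / Real.sqrt (m ^ 2 + n ^ 2)) (1 - m / Real.sqrt (m ^ 2 + n ^ 2))) ≤ |y| := by
  have ha : 0 < Real.sqrt (m ^ 2 + n ^ 2) := Real.sqrt_pos.2 (by positivity)
  have hma : m < Real.sqrt (m ^ 2 + n ^ 2) := Real.lt_sqrt_of_sq_lt (by nlinarith)
  have hb : 0 < Real.sqrt (x ^ 2 + y ^ 2) := Real.sqrt_pos.2 (by positivity)
  set r := m / Real.sqrt (m ^ 2 + n ^ 2) with hr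
  have hr0 : 0 < r := by positivity
  have hr1 : r < 1 := by rw [hr, div_lt_one ha]; exact hma
  set R := max r (1 - r) with hR
  have hR0 : 0 < R := lt_of_lt_of_le hr0 (le_max_left _ _)
  have hR1 : R < 1 := max_lt hr1 (by linarith)
  have hc1 : (m + x) / Real.sqrt ((m + x) ^ 2 + (n + y) ^ 2) ≤ 1 := by
    apply div_le_one_of_le₀ _ (Real.sqrt_nonneg _)
    exact Real.le_sqrt_of_sq_le (by nlinarith [sq_nonneg (n + y)])
  have hb2 : Real.sqrt (x ^ 2 + y ^ 2) ≤ |x| + |y| := by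
    apply Real.sqrt_le_iff.2
    refine ⟨by positivity, ?_⟩
    nlinarith [sq_abs x, sq_abs y, mul_nonneg (abs_nonneg x) (abs_nonneg y)]
  have key : |x| / Real.sqrt (x ^ 2 + y ^ 2) ≤ R := by
    rcases le_total 0 x with h | h
    · rw [abs_of_nonneg h]
      have : 0 ≤ (m + x) / Real.sqrt ((m + x) ^ 2 + (n + y) ^ 2) := by positivity
      have := le_max_left r (1 - r)
      linarith
    · rw [abs_of_nonpos h, neg_div]
      have := le_max_right r (1 - r)
      linarith
  rw [div_le_iff₀ hb] at key
  nlinarith [mul_le_mul_of_nonneg_left hb2 hR0.le, mul_le_mul_of_nonneg_right hR1.le (abs_nonneg y)]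

lemma aux_ne (m n : ℝ) (hm : 0 < m) (hn : 0 < n) (x y : ℝ) (hy : y ≠ 0)
    (hny : 0 < n + y) (hmx : 0 < m + x)
    (hF : (m + x) / Real.sqrt ((m + x) ^ 2 + (n + y) ^ 2) + x / Real.sqrt (x ^ 2 + y ^ 2)
      - m / Real.sqrt (m ^ 2 + n ^ 2) = 0) :
    x ≠ 0 ∧ n * x - m * y ≠ 0 ∧
      Real.sqrt ((m + x) ^ 2 + (n + y) ^ 2) ≠ Real.sqrt (m ^ 2 + n ^ 2) := by
  have ha : 0 < Real.sqrt (m ^ 2 + n ^ 2) := Real.sqrt_pos.2 (by positivity)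
  have hb : 0 < Real.sqrt (x ^ 2 + y ^ 2) := Real.sqrt_pos.2 (by positivity)
  have hc : 0 < Real.sqrt ((m + x) ^ 2 + (n + y) ^ 2) := Real.sqrt_pos.2 (by positivity)
  have ha2 := Real.sq_sqrt (show 0 ≤ m ^ 2 + n ^ 2 by positivity)
  have hc2 := Real.sq_sqrt (show 0 ≤ (m + x) ^ 2 + (n + y) ^ 2 by positivity)
  set a := Real.sqrt (m ^ 2 + n ^ 2)
  set b := Real.sqrt (x ^ 2 + y ^ 2)
  set c := Real.sqrt ((m + x) ^ 2 + (n + y) ^ 2)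
  have hx : x ≠ 0 := by
    rintro rfl
    have h1 : m / c = m / a := by simpa [sub_eq_zero] using hF
    have h2 : c = a := by
      field_simp at h1
      exact h1.symm
    rw [h2, ha2] at hc2
    have : y * (2 * n + y) = 0 := by linarith
    rcases mul_eq_zero.1 this with h | h
    · exact hy h
    · linarith
  refine ⟨hx, ?_, ?_⟩
  · intro hs
    have h1 : (m * c) ^ 2 = ((m + x) * a) ^ 2 := by
      rw [mul_pow, mul_pow, ha2, hc2]
      have : m * (n + y) = n * (m + x) := by linarith
      have h3 : (m * (n + y)) ^ 2 = (n * (m + x)) ^ 2 := by rw [this]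
      linarith
    have h2 : m * c = (m + x) * a :=
      (pow_left_inj₀ (by positivity) (by positivity) two_ne_zero).1 h1
    have h3 : (m + x) / c = m / a := by
      rw [div_eq_div_iff hc.ne' ha.ne']; linarith
    have h4 : x / b = 0 := by linarith
    rcases div_eq_zero_iff.1 h4 with h | h
    · exact hx h
    · exact hb.ne' h
  · intro h
    rw [h] at hF
    have : x * (a + b) = 0 := by
      field_simp at hF
      linarith
    rcases mul_eq_zero.1 this with h | h
    · exact hx h
    · linarith

lemma aux_ratio (N : ℝ) (hN : 0 < N) (m n : ℤ) (x y : ℝ) (hm : 0 < (m : ℝ))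
    (hmx : 0 < (m : ℝ) + x) (hx : x ≠ 0) (hs : (n : ℝ) * x - m * y ≠ 0)
    (hca : Real.sqrt (((m : ℝ) + x) ^ 2 + (n + y) ^ 2) ≠ Real.sqrt ((m : ℝ) ^ 2 + n ^ 2))
    (hba : Real.sqrt (x ^ 2 + y ^ 2) < Real.sqrt ((m : ℝ) ^ 2 + n ^ 2)) :
    efun N m n (x, y) / (Iplus N m n (x, y) * Iminus N m n (x, y)) =
      (Real.sqrt ((m : ℝ) ^ 2 + n ^ 2) + Real.sqrt (x ^ 2 + y ^ 2)) *
      (Real.sqrt (((m : ℝ) + x) ^ 2 + (n + y) ^ 2) + Real.sqrt ((m : ℝ) ^ 2 + n ^ 2)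
        - Real.sqrt (x ^ 2 + y ^ 2)) ^ 2 /
      (4 * N ^ 2 * Real.sqrt ((m : ℝ) ^ 2 + n ^ 2) ^ 2 *
        (Real.sqrt ((m : ℝ) ^ 2 + n ^ 2) - Real.sqrt (x ^ 2 + y ^ 2)) *
        (Real.sqrt ((m : ℝ) ^ 2 + n ^ 2) + Real.sqrt (x ^ 2 + y ^ 2) +
          Real.sqrt (((m : ℝ) + x) ^ 2 + (n + y) ^ 2)) ^ 2) := by
  have ha : 0 < Real.sqrt ((m : ℝ) ^ 2 + n ^ 2) := Real.sqrt_pos.2 (by positivity)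
  have hb : 0 < Real.sqrt (x ^ 2 + y ^ 2) := Real.sqrt_pos.2 (by positivity)
  have hc : 0 < Real.sqrt (((m : ℝ) + x) ^ 2 + (n + y) ^ 2) := Real.sqrt_pos.2 (by positivity)
  simp only [efun, Iplus, Iminus, Omg, Prod.mk_add_mk]
  generalize Real.sqrt ((m : ℝ) ^ 2 + n ^ 2) = a at *
  generalize Real.sqrt (x ^ 2 + y ^ 2) = b at *
  generalize Real.sqrt (((m : ℝ) + x) ^ 2 + (n + y) ^ 2) = c at *
  generalize (n : ℝ) * x - m * y = s at *
  generalize (m : ℝ) + x = u at *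
  have h1 : s * (N * u / c * (a ^ 2 - b ^ 2) + u * N * (a - b)) / (2 * (N * u / c) * c ^ 2)
      = s * (a - b) * (a + b + c) / (2 * c ^ 2) := by
    field_simp
    ring
  have h2 : -(s * (N * x / b * (a ^ 2 - c ^ 2) + x * N * (a - c))) / (2 * (N * x / b) * b ^ 2)
      = s * (c - a) * (a + b + c) / (2 * b ^ 2) := by
    field_simp
    ring
  rw [h1, h2]
  have h3 : c - a ≠ 0 := sub_ne_zero.2 hca
  have h4 : a - b ≠ 0 := (sub_pos.2 hba).ne'
  have h5 : a + b + c ≠ 0 := by positivity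
  field_simp
  ring

/-- in the small-Floquet regime, along the resonant branches,
`𝚎(μ(τ)) / (I₊(μ(τ))·I₋(μ(τ))) → 1/(4N²‖k‖²)` as `τ → 0`, `τ ≠ 0`. -/
theorem e_over_IpIm_small_floquet (N : ℝ) (hN : 0 < N) (m n : ℤ)
    (hm : 0 < m) (hn : 0 < n)
    (δ : ℝ) (hδ0 : 0 < δ) (hδn : δ < (n : ℝ))
    (φp φm : ℝ → ℝ)
    (hp : ∀ y : ℝ, 0 < y → y < δ → Ffun m n (φp y) y = 0)
    (hm' : ∀ y : ℝ, -δ < y → y < 0 → Ffun m n (φm y) y = 0) :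
    Filter.Tendsto
      (fun τ : ℝ =>
        let μ : ℝ × ℝ :=
          if 0 < τ then (φp ((n : ℝ) * τ), (n : ℝ) * τ)
          else (φm ((n : ℝ) * τ), (n : ℝ) * τ);
        efun N m n μ / (Iplus N m n μ * Iminus N m n μ))
      (nhdsWithin 0 {(0 : ℝ)}ᶜ)
      (nhds (1 / (4 * N ^ 2 * ((m : ℝ) ^ 2 + (n : ℝ) ^ 2)))) := by
  have hmR : (0 : ℝ) < m := by exact_mod_cast hm
  have hnR : (0 : ℝ) < n := by exact_mod_cast hn
  set X : ℝ → ℝ := fun τ => if 0 < τ then φp ((n : ℝ) * τ) else φm ((n : ℝ) * τ) with hX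
  have hμ : ∀ τ : ℝ, (if 0 < τ then (φp ((n : ℝ) * τ), (n : ℝ) * τ)
      else (φm ((n : ℝ) * τ), (n : ℝ) * τ)) = (X τ, (n : ℝ) * τ) := by
    intro τ
    simp only [hX]
    split_ifs <;> rfl
  simp only [hμ]
  have hY : Tendsto (fun τ : ℝ => (n : ℝ) * τ) (𝓝[≠] 0) (𝓝 0) := by
    have : Tendsto (fun τ : ℝ => (n : ℝ) * τ) (𝓝 0) (𝓝 ((n : ℝ) * 0)) :=
      (continuous_const.mul continuous_id).tendsto 0
    rw [mul_zero] at this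
    exact this.mono_left nhdsWithin_le_nhds
  have hne : ∀ᶠ τ : ℝ in 𝓝[≠] 0, τ ≠ 0 := eventually_mem_nhdsWithin
  have hF : ∀ᶠ τ : ℝ in 𝓝[≠] 0, Ffun m n (X τ) ((n : ℝ) * τ) = 0 := by
    filter_upwards [hne, hY.eventually (Ioo_mem_nhds (neg_lt_zero.2 hδ0) hδ0)] with τ h0 h1
    simp only [hX]
    split_ifs with h
    · exact hp _ (by positivity) h1.2
    · exact hm' _ h1.1 (mul_neg_of_pos_of_neg hnR (lt_of_le_of_ne (not_lt.1 h) h0))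
  set R : ℝ := max ((m : ℝ) / Real.sqrt ((m : ℝ) ^ 2 + n ^ 2))
    (1 - (m : ℝ) / Real.sqrt ((m : ℝ) ^ 2 + n ^ 2)) with hR
  have ha : 0 < Real.sqrt ((m : ℝ) ^ 2 + (n : ℝ) ^ 2) := Real.sqrt_pos.2 (by positivity)
  have hR1 : R < 1 := by
    have hma : (m : ℝ) < Real.sqrt ((m : ℝ) ^ 2 + (n : ℝ) ^ 2) :=
      Real.lt_sqrt_of_sq_lt (by nlinarith)
    refine max_lt ((div_lt_one ha).2 hma) ?_
    have : 0 < (m : ℝ) / Real.sqrt ((m : ℝ) ^ 2 + n ^ 2) := by positivity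
    linarith
  have hX0 : Tendsto X (𝓝[≠] 0) (𝓝 0) := by
    have hg : Tendsto (fun τ : ℝ => |(n : ℝ) * τ| / (1 - R)) (𝓝[≠] 0) (𝓝 0) := by
      simpa using hY.abs.div_const (1 - R)
    refine squeeze_zero_norm' ?_ hg
    filter_upwards [hF, hne] with τ h h0
    rw [Real.norm_eq_abs, le_div_iff₀ (by linarith)]
    exact aux_bound m n hmR hnR (X τ) ((n : ℝ) * τ) (mul_ne_zero hnR.ne' h0) h
  have hb : Tendsto (fun τ => Real.sqrt (X τ ^ 2 + ((n : ℝ) * τ) ^ 2)) (𝓝[≠] 0) (𝓝 0) := by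
    simpa using ((hX0.pow 2).add (hY.pow 2)).sqrt
  have hc : Tendsto (fun τ => Real.sqrt (((m : ℝ) + X τ) ^ 2 + ((n : ℝ) + (n : ℝ) * τ) ^ 2))
      (𝓝[≠] 0) (𝓝 (Real.sqrt ((m : ℝ) ^ 2 + (n : ℝ) ^ 2))) := by
    simpa using (((hX0.const_add (m : ℝ)).pow 2).add ((hY.const_add (n : ℝ)).pow 2)).sqrt
  have hev : ∀ᶠ τ : ℝ in 𝓝[≠] 0,
      (Real.sqrt ((m : ℝ) ^ 2 + n ^ 2) + Real.sqrt (X τ ^ 2 + ((n : ℝ) * τ) ^ 2)) *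
      (Real.sqrt (((m : ℝ) + X τ) ^ 2 + (n + (n : ℝ) * τ) ^ 2) + Real.sqrt ((m : ℝ) ^ 2 + n ^ 2)
        - Real.sqrt (X τ ^ 2 + ((n : ℝ) * τ) ^ 2)) ^ 2 /
      (4 * N ^ 2 * Real.sqrt ((m : ℝ) ^ 2 + n ^ 2) ^ 2 *
        (Real.sqrt ((m : ℝ) ^ 2 + n ^ 2) - Real.sqrt (X τ ^ 2 + ((n : ℝ) * τ) ^ 2)) *
        (Real.sqrt ((m : ℝ) ^ 2 + n ^ 2) + Real.sqrt (X τ ^ 2 + ((n : ℝ) * τ) ^ 2) +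
          Real.sqrt (((m : ℝ) + X τ) ^ 2 + (n + (n : ℝ) * τ) ^ 2)) ^ 2) =
      efun N m n (X τ, (n : ℝ) * τ) /
        (Iplus N m n (X τ, (n : ℝ) * τ) * Iminus N m n (X τ, (n : ℝ) * τ)) := by
    filter_upwards [hF, hne, hX0.eventually (lt_mem_nhds (neg_lt_zero.2 hmR)),
      hY.eventually (lt_mem_nhds (neg_lt_zero.2 hnR)), hb.eventually (gt_mem_nhds ha)]
      with τ h h0 h1 h2 h3
    have hmx : 0 < (m : ℝ) + X τ := by linarith
    obtain ⟨q1, q2, q3⟩ := aux_ne m n hmR hnR (X τ) ((n : ℝ) * τ) (mul_ne_zero hnR.ne' h0)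
      (by linarith) hmx h
    exact (aux_ratio N hN m n (X τ) ((n : ℝ) * τ) hmR hmx q1 q2 q3 h3).symm
  refine Tendsto.congr' hev ?_
  have ha2 := Real.sq_sqrt (show 0 ≤ (m : ℝ) ^ 2 + (n : ℝ) ^ 2 by positivity)
  set a := Real.sqrt ((m : ℝ) ^ 2 + (n : ℝ) ^ 2) with haa
  have hlim : 1 / (4 * N ^ 2 * a ^ 2) =
      (a + 0) * (a + a - 0) ^ 2 / (4 * N ^ 2 * a ^ 2 * (a - 0) * (a + 0 + a) ^ 2) := by
    simp only [sub_zero, add_zero]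
    field_simp
  rw [← ha2, hlim]
  refine Tendsto.div ((hb.const_add a).mul (((hc.add_const a).sub hb).pow 2))
    (((hb.const_sub a).const_mul _).mul (((hb.const_add a).add hc).pow 2)) ?_
  simp only [sub_zero, add_zero]
  positivity
end
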